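/- arXiv:2407.06389 — 2 statements merged into one kernel-verified Lean document; each statement's English description precedes it below -/
import Mathlib

section
/- Let V, W ∈ P₂(Tℝᵈ) be probability measures on the tangent bundle with finite second moment. Set C = max{1, (∫_{Tℝᵈ} |v|² dV(x,v))^{1/2}}. Then for every φ ∈ C_c^∞(ℝᵈ) one has |⟨∇φ, V⟩ − ⟨∇φ, W⟩| ≤ C · ‖∇φ‖_{W^{1,∞}} · W₂(V, W), where ‖∇φ‖_{W^{1,∞}} = ‖∇φ‖_∞ + ‖∇²φ‖_∞. -/
open MeasureTheory ENNReal Filter Topology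

noncomputable section

abbrev Eu (d : ℕ) := EuclideanSpace ℝ (Fin d)

/-- The set of couplings (transport plans) between two measures. -/
def couplings {X Y : Type*} [MeasurableSpace X] [MeasurableSpace Y]
    (μ : Measure X) (ν : Measure Y) : Set (Measure (X × Y)) :=
  {γ | γ.map Prod.fst = μ ∧ γ.map Prod.snd = ν}

/-- The total transport cost of a plan `γ` with respect to a cost function `c`. -/
def cost {X Y : Type*} [MeasurableSpace X] [MeasurableSpace Y]
    (c : X → Y → ℝ≥0∞) (γ : Measure (X × Y)) : ℝ≥0∞ :=
  ∫⁻ p, c p.1 p.2 ∂γ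

/-- Optimal transport cost between `μ` and `ν` for the cost `c`. -/
def minCost {X Y : Type*} [MeasurableSpace X] [MeasurableSpace Y]
    (c : X → Y → ℝ≥0∞) (μ : Measure X) (ν : Measure Y) : ℝ≥0∞ :=
  ⨅ γ ∈ couplings μ ν, cost c γ

/-- Optimal couplings between `μ` and `ν` for the cost `c`. -/
def optCouplingsFor {X Y : Type*} [MeasurableSpace X] [MeasurableSpace Y]
    (c : X → Y → ℝ≥0∞) (μ : Measure X) (ν : Measure Y) : Set (Measure (X × Y)) :=
  {γ | γ ∈ couplings μ ν ∧ cost c γ = minCost c μ ν}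

/-- Quadratic cost. -/
def sqDist {Z : Type*} [PseudoEMetricSpace Z] : Z → Z → ℝ≥0∞ := fun x y => edist x y ^ 2

/-- The 2-Wasserstein distance. -/
def W2 {Z : Type*} [MeasurableSpace Z] [PseudoEMetricSpace Z] (μ ν : Measure Z) : ℝ :=
  Real.sqrt (minCost sqDist μ ν).toReal

/-- Optimal couplings `Γ_o(μ, ν)` for the quadratic cost. -/
def optCouplings {Z : Type*} [MeasurableSpace Z] [PseudoEMetricSpace Z]
    (μ ν : Measure Z) : Set (Measure (Z × Z)) :=
  optCouplingsFor sqDist μ ν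

/-- The Euclidean quadratic cost on the tangent bundle `TZ = Z × Z`. -/
def tanSqDist {Z : Type*} [PseudoEMetricSpace Z] : Z × Z → Z × Z → ℝ≥0∞ :=
  fun p q => edist p.1 q.1 ^ 2 + edist p.2 q.2 ^ 2

/-- The 2-Wasserstein distance on measures on the tangent bundle `TZ = Z × Z`,
for the (ℓ²-product) Euclidean metric on `TZ`. -/
def W2T {Z : Type*} [MeasurableSpace Z] [PseudoEMetricSpace Z]
    (μ ν : Measure (Z × Z)) : ℝ :=
  Real.sqrt (minCost tanSqDist μ ν).toReal

/-- `P₂(Z)`: Borel probability measures with finite second moment. -/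
def P2 (Z : Type*) [MeasurableSpace Z] [NormedAddCommGroup Z] : Set (Measure Z) :=
  {μ | IsProbabilityMeasure μ ∧ ∫⁻ x, (‖x‖₊ : ℝ≥0∞) ^ 2 ∂μ < ⊤}

/-- `P₂(TZ)`: probability measures on the tangent bundle with finite second moment. -/
def P2T (Z : Type*) [MeasurableSpace Z] [NormedAddCommGroup Z] : Set (Measure (Z × Z)) :=
  {V | IsProbabilityMeasure V ∧ ∫⁻ p, ((‖p.1‖₊ : ℝ≥0∞) ^ 2 + (‖p.2‖₊ : ℝ≥0∞) ^ 2) ∂V < ⊤}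

/-- Cauchy–Schwarz for the Lebesgue integral. -/
lemma lintegral_mul_le_sqrt_mul_sqrt {X : Type*} [MeasurableSpace X] (μ : Measure X)
    {f g : X → ℝ≥0∞} (hf : AEMeasurable f μ) (hg : AEMeasurable g μ) :
    ∫⁻ x, f x * g x ∂μ ≤
      (∫⁻ x, f x ^ 2 ∂μ) ^ (1 / 2 : ℝ) * (∫⁻ x, g x ^ 2 ∂μ) ^ (1 / 2 : ℝ) := by
  simpa using ENNReal.lintegral_mul_le_Lp_mul_Lq μ Real.HolderConjugate.two_two hf hg

lemma edist_sq_le {Z : Type*} [NormedAddCommGroup Z] (x y : Z) :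
    edist x y ^ 2 ≤ 2 * (‖x‖ₑ ^ 2 + ‖y‖ₑ ^ 2) := by
  have h : edist x y ≤ ‖x‖ₑ + ‖y‖ₑ := by
    rw [edist_eq_enorm_sub]; exact enorm_sub_le
  have h2 := ENNReal.rpow_add_le_mul_rpow_add_rpow ‖x‖ₑ ‖y‖ₑ one_le_two
  norm_num at h2
  exact (pow_le_pow_left' h 2).trans h2

/-- The product plan shows that the transport cost between measures with finite second moment
is finite. -/
lemma minCost_tanSqDist_ne_top {Z : Type*} [NormedAddCommGroup Z] [MeasurableSpace Z]
    [BorelSpace Z] [SecondCountableTopology Z] {V W : Measure (Z × Z)}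
    (hV : V ∈ P2T Z) (hW : W ∈ P2T Z) : minCost tanSqDist V W ≠ ⊤ := by
  obtain ⟨hVp, hV⟩ := hV
  obtain ⟨hWp, hW⟩ := hW
  have hmem : V.prod W ∈ couplings V W := by
    simp [couplings, Measure.map_fst_prod, Measure.map_snd_prod]
  refine ((iInf₂_le _ hmem).trans_lt ?_).ne
  let m : Z × Z → ℝ≥0∞ := fun p => (‖p.1‖₊ : ℝ≥0∞) ^ 2 + (‖p.2‖₊ : ℝ≥0∞) ^ 2
  have hm : Measurable m := by fun_prop
  calc cost tanSqDist (V.prod W) ≤ ∫⁻ z, 2 * (m z.1 + m z.2) ∂(V.prod W) := by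
        refine lintegral_mono fun z => ?_
        refine (add_le_add (edist_sq_le z.1.1 z.2.1) (edist_sq_le z.1.2 z.2.2)).trans_eq ?_
        simp only [m, enorm_eq_nnnorm]
        ring
    _ = 2 * (∫⁻ p, m p ∂V + ∫⁻ q, m q ∂W) := by
        have h1 := (measurePreserving_fst (μ := V) (ν := W)).lintegral_comp hm
        have h2 := (measurePreserving_snd (μ := V) (ν := W)).lintegral_comp hm
        rw [lintegral_const_mul _ (by fun_prop), lintegral_add_left (by fun_prop), h1, h2]
    _ < ⊤ := ENNReal.mul_lt_top (by simp) (ENNReal.add_lt_top.2 ⟨hV, hW⟩)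

section

variable {E : Type*} [NormedAddCommGroup E] [NormedSpace ℝ E]

/-- A bounded Lipschitz field of linear forms `F` yields a locally Lipschitz function
`(x, v) ↦ F x v` on the tangent bundle. -/
lemma enorm_apply_sub_apply_le {F : E → E →L[ℝ] ℝ} {A B : ℝ} (hA : 0 ≤ A) (hB : 0 ≤ B)
    (hFA : ∀ x, ‖F x‖ ≤ A) (hFB : ∀ x y, ‖F x - F y‖ ≤ B * ‖x - y‖) (p q : E × E) :
    ‖F p.1 p.2 - F q.1 q.2‖ₑ ≤
      ENNReal.ofReal B * (edist p.1 q.1 * ‖p.2‖ₑ) + ENNReal.ofReal A * edist p.2 q.2 := by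
  have h : ‖F p.1 p.2 - F q.1 q.2‖ ≤ B * (‖p.1 - q.1‖ * ‖p.2‖) + A * ‖p.2 - q.2‖ := by
    have e : F p.1 p.2 - F q.1 q.2 = (F p.1 - F q.1) p.2 + F q.1 (p.2 - q.2) := by
      simp
    rw [e, ← mul_assoc]
    exact (norm_add_le _ _).trans (add_le_add
      ((F p.1 - F q.1).le_of_opNorm_le (hFB _ _) _) ((F q.1).le_of_opNorm_le (hFA _) _))
  simp only [edist_eq_enorm_sub, ← ofReal_norm]
  rw [← ENNReal.ofReal_mul (norm_nonneg _), ← ENNReal.ofReal_mul hA, ← ENNReal.ofReal_mul hB,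
    ← ENNReal.ofReal_add (by positivity) (by positivity)]
  exact ENNReal.ofReal_le_ofReal h

variable [MeasurableSpace E] [BorelSpace E] [SecondCountableTopology E]

lemma integrable_apply_of_mem_P2T {F : E → E →L[ℝ] ℝ} (hF : Continuous F) {A : ℝ}
    (hFA : ∀ x, ‖F x‖ ≤ A) {V : Measure (E × E)} (hV : V ∈ P2T E) :
    Integrable (fun p : E × E => F p.1 p.2) V := by
  obtain ⟨hVp, hV⟩ := hV
  have hL2 : MemLp (fun p : E × E => p.2) 2 V := by
    refine ⟨by fun_prop, ?_⟩
    rw [eLpNorm_lt_top_iff_lintegral_rpow_enorm_lt_top (by simp) (by simp)]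
    refine lt_of_le_of_lt (lintegral_mono fun p => ?_) hV
    simp [enorm_eq_nnnorm]
  have hL1 : Integrable (fun p : E × E => p.2) V := hL2.integrable (by norm_num)
  refine (hL1.norm.const_mul A).mono' (by fun_prop) (ae_of_all _ fun p => ?_)
  exact (F p.1).le_of_opNorm_le (hFA _) _

lemma enorm_integral_sub_le_of_mem_couplings {F : E → E →L[ℝ] ℝ} (hF : Continuous F) {A B : ℝ}
    (hA : 0 ≤ A) (hB : 0 ≤ B) (hFA : ∀ x, ‖F x‖ ≤ A) (hFB : ∀ x y, ‖F x - F y‖ ≤ B * ‖x - y‖)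
    {V W : Measure (E × E)} (hV : V ∈ P2T E) (hW : W ∈ P2T E)
    {γ : Measure ((E × E) × (E × E))} (hγ : γ ∈ couplings V W) :
    ‖(∫ p, F p.1 p.2 ∂V) - ∫ p, F p.1 p.2 ∂W‖ₑ ≤
      (ENNReal.ofReal B * (∫⁻ p, ‖p.2‖ₑ ^ 2 ∂V) ^ (1 / 2 : ℝ) + ENNReal.ofReal A) *
        cost tanSqDist γ ^ (1 / 2 : ℝ) := by
  have hVi := integrable_apply_of_mem_P2T hF hFA hV
  have hWi := integrable_apply_of_mem_P2T hF hFA hW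
  have hVp := hV.1
  obtain ⟨h1, h2⟩ := hγ
  have hm1 : MeasurePreserving Prod.fst γ V := ⟨measurable_fst, h1⟩
  have hm2 : MeasurePreserving Prod.snd γ W := ⟨measurable_snd, h2⟩
  have hγp : IsProbabilityMeasure γ := ⟨by
    rw [← Set.preimage_univ (f := Prod.fst),
      hm1.measure_preimage MeasurableSet.univ.nullMeasurableSet, measure_univ]⟩
  have e1 : ∫ p, F p.1 p.2 ∂V = ∫ z, F z.1.1 z.1.2 ∂γ := by
    rw [← h1] at hVi ⊢
    exact integral_map (by fun_prop) hVi.aestronglyMeasurable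
  have e2 : ∫ p, F p.1 p.2 ∂W = ∫ z, F z.2.1 z.2.2 ∂γ := by
    rw [← h2] at hWi ⊢
    exact integral_map (by fun_prop) hWi.aestronglyMeasurable
  have e3 : ∫⁻ p, ‖p.2‖ₑ ^ 2 ∂V = ∫⁻ z, ‖z.1.2‖ₑ ^ 2 ∂γ :=
    (hm1.lintegral_comp (f := fun p : E × E => ‖p.2‖ₑ ^ 2) (by fun_prop)).symm
  have c1 : ∫⁻ z, edist z.1.1 z.2.1 ^ 2 ∂γ ≤ cost tanSqDist γ :=
    lintegral_mono fun z => le_self_add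
  have c2 : ∫⁻ z, edist z.1.2 z.2.2 ^ 2 ∂γ ≤ cost tanSqDist γ :=
    lintegral_mono fun z => le_add_self
  have i1 : ∫⁻ z, edist z.1.1 z.2.1 * ‖z.1.2‖ₑ ∂γ ≤
      cost tanSqDist γ ^ (1 / 2 : ℝ) * (∫⁻ z, ‖z.1.2‖ₑ ^ 2 ∂γ) ^ (1 / 2 : ℝ) := by
    refine (lintegral_mul_le_sqrt_mul_sqrt γ (by fun_prop) (by fun_prop)).trans ?_
    gcongr
  have i2 : ∫⁻ z, edist z.1.2 z.2.2 ∂γ ≤ cost tanSqDist γ ^ (1 / 2 : ℝ) := by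
    have h := lintegral_mul_le_sqrt_mul_sqrt γ (f := fun z => edist z.1.2 z.2.2) (g := fun _ => 1)
      (by fun_prop) (by fun_prop)
    simp only [mul_one, one_pow, lintegral_const, measure_univ, ENNReal.one_rpow] at h
    refine h.trans ?_
    gcongr
  have hVγ : Integrable (fun z : (E × E) × E × E => F z.1.1 z.1.2) γ :=
    hm1.integrable_comp_of_integrable hVi
  have hWγ : Integrable (fun z : (E × E) × E × E => F z.2.1 z.2.2) γ :=
    hm2.integrable_comp_of_integrable hWi
  rw [e1, e2, e3, ← integral_sub hVγ hWγ]
  calc ‖∫ z, F z.1.1 z.1.2 - F z.2.1 z.2.2 ∂γ‖ₑ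
      ≤ ∫⁻ z, ‖F z.1.1 z.1.2 - F z.2.1 z.2.2‖ₑ ∂γ := enorm_integral_le_lintegral_enorm _
    _ ≤ ∫⁻ z, ENNReal.ofReal B * (edist z.1.1 z.2.1 * ‖z.1.2‖ₑ) +
          ENNReal.ofReal A * edist z.1.2 z.2.2 ∂γ :=
        lintegral_mono fun z => enorm_apply_sub_apply_le hA hB hFA hFB z.1 z.2
    _ = ENNReal.ofReal B * ∫⁻ z, edist z.1.1 z.2.1 * ‖z.1.2‖ₑ ∂γ +
          ENNReal.ofReal A * ∫⁻ z, edist z.1.2 z.2.2 ∂γ := by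
        rw [lintegral_add_left (by fun_prop), lintegral_const_mul _ (by fun_prop),
          lintegral_const_mul _ (by fun_prop)]
    _ ≤ _ := by
        refine (add_le_add (mul_le_mul_right i1 _) (mul_le_mul_right i2 _)).trans_eq ?_
        ring

/-- The difference of the pairings of `F` with `V` and `W` is controlled by `W2T V W`. -/
lemma abs_integral_sub_le_mul_W2T {F : E → E →L[ℝ] ℝ} (hF : Continuous F) {A B : ℝ}
    (hA : 0 ≤ A) (hB : 0 ≤ B) (hFA : ∀ x, ‖F x‖ ≤ A) (hFB : ∀ x y, ‖F x - F y‖ ≤ B * ‖x - y‖)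
    {V W : Measure (E × E)} (hV : V ∈ P2T E) (hW : W ∈ P2T E) :
    |(∫ p, F p.1 p.2 ∂V) - ∫ p, F p.1 p.2 ∂W| ≤
      (B * Real.sqrt (∫⁻ p, ‖p.2‖ₑ ^ 2 ∂V).toReal + A) * W2T V W := by
  have hS : ∫⁻ p, ‖p.2‖ₑ ^ 2 ∂V ≠ ⊤ :=
    (lt_of_le_of_lt (lintegral_mono fun p => le_add_self) hV.2).ne
  set K : ℝ≥0∞ := ENNReal.ofReal B * (∫⁻ p, ‖p.2‖ₑ ^ 2 ∂V) ^ (1 / 2 : ℝ) + ENNReal.ofReal A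
    with hK
  have hKtop : K ≠ ⊤ := by
    simp [hK, ENNReal.mul_eq_top, ENNReal.rpow_eq_top_iff, hS]
  have hKreal : K.toReal = B * Real.sqrt (∫⁻ p, ‖p.2‖ₑ ^ 2 ∂V).toReal + A := by
    rw [hK, ENNReal.toReal_add (by simp [ENNReal.mul_eq_top, ENNReal.rpow_eq_top_iff, hS])
      (by simp), ENNReal.toReal_mul, ENNReal.toReal_ofReal hA, ENNReal.toReal_ofReal hB,
      ← ENNReal.toReal_rpow, Real.sqrt_eq_rpow]
  have hmin := minCost_tanSqDist_ne_top hV hW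
  have key : ‖(∫ p, F p.1 p.2 ∂V) - ∫ p, F p.1 p.2 ∂W‖ₑ ≤
      K * minCost tanSqDist V W ^ (1 / 2 : ℝ) := by
    have hγ (γ) (h : γ ∈ couplings V W) :=
      enorm_integral_sub_le_of_mem_couplings hF hA hB hFA hFB hV hW h
    rcases eq_or_ne K 0 with hK0 | hK0
    · obtain ⟨γ, h, -⟩ : ∃ γ, ∃ _ : γ ∈ couplings V W, cost tanSqDist γ < ⊤ := by
        simpa only [minCost, iInf_lt_iff] using hmin.lt_top
      have h0 := hγ γ h
      rw [← hK, hK0, zero_mul] at h0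
      exact h0.trans zero_le
    · rw [mul_comm, ← ENNReal.div_le_iff hK0 hKtop, ← ENNReal.rpow_le_rpow_iff two_pos,
        ← ENNReal.rpow_mul]
      norm_num only [ENNReal.rpow_one]
      refine le_iInf₂ fun γ h => ?_
      have := hγ γ h
      rw [← hK, mul_comm, ← ENNReal.div_le_iff hK0 hKtop,
        ← ENNReal.rpow_le_rpow_iff two_pos, ← ENNReal.rpow_mul] at this
      norm_num only [ENNReal.rpow_one] at this
      exact this
  have := ENNReal.toReal_mono (ENNReal.mul_ne_top hKtop (by simp [hmin])) key
  rwa [toReal_enorm, Real.norm_eq_abs, ENNReal.toReal_mul, hKreal, ← ENNReal.toReal_rpow,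
    ← Real.sqrt_eq_rpow] at this

end

lemma bddAbove_range_norm {X E : Type*} [TopologicalSpace X] [NormedAddCommGroup E]
    {f : X → E} (hf : Continuous f) (hc : HasCompactSupport f) :
    BddAbove (Set.range fun x => ‖f x‖) :=
  (hf.bounded_above_of_compact_support hc).imp fun _ hC => Set.forall_mem_range.2 hC

/-- For `V, W ∈ P₂(Tℝᵈ)` and every `φ ∈ C_c^∞(ℝᵈ)`,
`|⟨∇φ, V⟩ − ⟨∇φ, W⟩| ≤ C ‖∇φ‖_{W^{1,∞}} W₂(V, W)` with
`C = max {1, (∫ |v|² dV)^{1/2}}` and `‖∇φ‖_{W^{1,∞}} = ‖∇φ‖_∞ + ‖∇²φ‖_∞`. -/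
theorem vector_field_bound {d : ℕ} (V W : Measure (Eu d × Eu d))
    (hV : V ∈ P2T (Eu d)) (hW : W ∈ P2T (Eu d))
    (φ : Eu d → ℝ) (hφ : ContDiff ℝ (⊤ : ℕ∞) φ) (hφc : HasCompactSupport φ) :
    |(∫ p : Eu d × Eu d, fderiv ℝ φ p.1 p.2 ∂V) -
        ∫ p : Eu d × Eu d, fderiv ℝ φ p.1 p.2 ∂W| ≤
      max 1 (Real.sqrt (∫⁻ p : Eu d × Eu d, (‖p.2‖₊ : ℝ≥0∞) ^ 2 ∂V).toReal) *
        ((⨆ x, ‖fderiv ℝ φ x‖) + ⨆ x, ‖fderiv ℝ (fderiv ℝ φ) x‖) * W2T V W := by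
  have hF1 : ContDiff ℝ 1 (fderiv ℝ φ) := hφ.fderiv_right (by norm_cast)
  have hF := hF1.continuous
  have hc := hφc.fderiv (𝕜 := ℝ)
  have hbA := bddAbove_range_norm hF hc
  have hbB := bddAbove_range_norm (hF1.continuous_fderiv (by simp)) (hc.fderiv (𝕜 := ℝ))
  have hA : 0 ≤ ⨆ x, ‖fderiv ℝ φ x‖ := Real.iSup_nonneg fun _ => ContinuousLinearMap.opNorm_nonneg _
  have hB : 0 ≤ ⨆ x, ‖fderiv ℝ (fderiv ℝ φ) x‖ := Real.iSup_nonneg fun _ => ContinuousLinearMap.opNorm_nonneg _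
  have hFB (x y) : ‖fderiv ℝ φ x - fderiv ℝ φ y‖ ≤
      (⨆ x, ‖fderiv ℝ (fderiv ℝ φ) x‖) * ‖x - y‖ :=
    convex_univ.norm_image_sub_le_of_norm_fderiv_le
      (fun z _ => (hF1.differentiable (by simp)).differentiableAt)
      (fun z _ => le_ciSup hbB z) (Set.mem_univ y) (Set.mem_univ x)
  have hFA (x) : ‖fderiv ℝ φ x‖ ≤ ⨆ x, ‖fderiv ℝ φ x‖ := le_ciSup hbA x
  have key := abs_integral_sub_le_mul_W2T hF hA hB hFA hFB hV hW
  simp only [enorm_eq_nnnorm] at key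
  generalize (⨆ x, ‖fderiv ℝ φ x‖) = A at *
  generalize (⨆ x, ‖fderiv ℝ (fderiv ℝ φ) x‖) = B at *
  refine key.trans (mul_le_mul_of_nonneg_right ?_ (Real.sqrt_nonneg _))
  rw [mul_add, add_comm, mul_comm B]
  exact add_le_add (le_mul_of_one_le_left hA (le_max_left _ _))
    (mul_le_mul_of_nonneg_right (le_max_right _ _) hB)

end
end

section
/- Let μ₀, μ̄ ∈ P₂(ℝᵈ) and fix γ ∈ Γ_o(μ₀, μ̄). For τ ∈ [0,1] let π_τ(x,y) = (1−τ)x + τy and μ_τ = (π_τ)_# γ be the induced geodesic between μ₀ and μ̄. Then the time-rescaled curve ν_t := μ_{1−e^{−t}}, t ≥ 0, is a solution of the measure differential inclusion ν̇_t ∈ (π₀, π₁−π₀)_# Γ_o(ν_t, μ̄) with ν₀ = μ₀; explicitly, for every φ ∈ C_c^∞(ℝᵈ) and every t ≥ 0 there exists γ_t ∈ Γ_o(ν_t, μ̄) with (d/dt)∫_{ℝᵈ} φ(x) dν_t(x) = ∫_{Tℝᵈ} v·∇φ(x) d[(π₀, π₁−π₀)_# γ_t](x,v). -/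
open MeasureTheory ENNReal Filter Topology

noncomputable section

open ProbabilityTheory

theorem isProbabilityMeasure_of_mem_couplings {X Y : Type*} [MeasurableSpace X]
    [MeasurableSpace Y] {μ : Measure X} {ν : Measure Y} [IsProbabilityMeasure μ]
    {γ : Measure (X × Y)} (hγ : γ ∈ couplings μ ν) : IsProbabilityMeasure γ :=
  ⟨by rw [← Set.preimage_univ (f := Prod.fst),
    ← Measure.map_apply measurable_fst MeasurableSet.univ, hγ.1, measure_univ]⟩

/-- Gluing: a measure `γ` on `Ω` and a measure `η` on `Z × Y` whose first marginal is the law of `f`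
under `γ` are both images of one measure on `Ω × Y`. -/
theorem exists_gluing {Ω Y Z : Type*} [MeasurableSpace Ω] [MeasurableSpace Y] [MeasurableSpace Z]
    [StandardBorelSpace Y] [Nonempty Y] (γ : Measure Ω) [IsFiniteMeasure γ]
    (η : Measure (Z × Y)) [IsFiniteMeasure η] {f : Ω → Z} (hf : Measurable f)
    (h : η.map Prod.fst = γ.map f) :
    ∃ ρ : Measure (Ω × Y), ρ.map Prod.fst = γ ∧ ρ.map (Prod.map f id) = η := by
  refine ⟨γ ⊗ₘ (η.condKernel.comap f hf), Measure.fst_compProd γ _, ?_⟩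
  ext s hs
  have hfm : Measurable (Prod.map f (id : Y → Y)) := hf.prodMap measurable_id
  rw [Measure.map_apply hfm hs, Measure.compProd_apply (hfm hs)]
  conv_rhs => rw [← η.disintegrate η.condKernel, Measure.compProd_apply hs, Measure.fst, h,
    lintegral_map (Kernel.measurable_kernel_prodMk_left hs) hf]
  rfl

/-- Young's inequality for the squared distance between `x` and `w`, through the point
`a • x + (1 - a) • y` of the segment from `x` to `y`. -/
theorem sqDist_le_of_segment {E : Type*} [NormedAddCommGroup E] [NormedSpace ℝ E]
    {a : ℝ} (ha : 0 < a) (ha1 : a ≤ 1) (x y w : E) :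
    sqDist x w ≤ ENNReal.ofReal (1 - a) * sqDist x y
      + ENNReal.ofReal a⁻¹ * sqDist (a • x + (1 - a) • y) w := by
  have hb : 0 ≤ 1 - a := by linarith
  simp only [sqDist, edist_dist]
  rw [← ENNReal.ofReal_pow dist_nonneg, ← ENNReal.ofReal_pow dist_nonneg,
    ← ENNReal.ofReal_pow dist_nonneg, ← ENNReal.ofReal_mul hb,
    ← ENNReal.ofReal_mul (by positivity), ← ENNReal.ofReal_add (by positivity) (by positivity)]
  apply ENNReal.ofReal_le_ofReal
  have htri : dist x w ≤ (1 - a) * dist x y + dist (a • x + (1 - a) • y) w := by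
    refine (dist_triangle x (a • x + (1 - a) • y) w).trans (add_le_add_left (le_of_eq ?_) _)
    rw [dist_eq_norm, dist_eq_norm, ← Real.norm_of_nonneg hb, ← norm_smul,
      Real.norm_of_nonneg hb]
    congr 1
    module
  set u := dist x y
  set v := dist (a • x + (1 - a) • y) w
  have hyoung : ((1 - a) * u + v) ^ 2 ≤ (1 - a) * u ^ 2 + a⁻¹ * v ^ 2 := by
    have hdiff : (1 - a) * u ^ 2 + a⁻¹ * v ^ 2 - ((1 - a) * u + v) ^ 2
        = (1 - a) * a⁻¹ * (a * u - v) ^ 2 := by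
      field_simp
      ring
    have : 0 ≤ (1 - a) * a⁻¹ * (a * u - v) ^ 2 := by positivity
    linarith
  exact (pow_le_pow_left₀ dist_nonneg htri 2).trans hyoung

theorem cost_sqDist_lt_top {d : ℕ} {μ ν : Measure (Eu d)} (hμ : μ ∈ P2 (Eu d))
    (hν : ν ∈ P2 (Eu d)) {γ : Measure (Eu d × Eu d)} (hγ : γ ∈ couplings μ ν) :
    cost sqDist γ < ⊤ := by
  have h1 : ∫⁻ p, (‖p.1‖₊ : ℝ≥0∞) ^ 2 ∂γ < ⊤ := by
    have h := hμ.2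
    rwa [← hγ.1, lintegral_map (by fun_prop) measurable_fst] at h
  have h2 : ∫⁻ p, (‖p.2‖₊ : ℝ≥0∞) ^ 2 ∂γ < ⊤ := by
    have h := hν.2
    rwa [← hγ.2, lintegral_map (by fun_prop) measurable_snd] at h
  have hle : cost sqDist γ ≤
      ∫⁻ p, 2 * ((‖p.1‖₊ : ℝ≥0∞) ^ 2 + (‖p.2‖₊ : ℝ≥0∞) ^ 2) ∂γ := by
    refine lintegral_mono fun p => ?_
    simp only [sqDist, edist_nndist]
    norm_cast
    rw [← NNReal.coe_le_coe]
    push_cast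
    have h := (dist_eq_norm p.1 p.2).trans_le (norm_sub_le p.1 p.2)
    have h' := pow_le_pow_left₀ dist_nonneg h 2
    nlinarith [sq_nonneg (‖p.1‖ - ‖p.2‖)]
  refine hle.trans_lt ?_
  rw [lintegral_const_mul _ (by fun_prop), lintegral_add_left (by fun_prop)]
  exact ENNReal.mul_lt_top (by simp) (ENNReal.add_lt_top.2 ⟨h1, h2⟩)

theorem measurable_sqDist {d : ℕ} :
    Measurable fun p : Eu d × Eu d => sqDist p.1 p.2 := by
  unfold sqDist
  fun_prop

/-- The final part of a geodesic is a geodesic: moving the first marginal of an optimal coupling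
along the segments towards the second one keeps it optimal. -/
theorem map_segment_mem_optCouplings {d : ℕ} {μ ν : Measure (Eu d)} (hμ : μ ∈ P2 (Eu d))
    (hν : ν ∈ P2 (Eu d)) {γ : Measure (Eu d × Eu d)} (hγ : γ ∈ optCouplings μ ν)
    {a : ℝ} (ha : 0 < a) (ha1 : a ≤ 1) :
    γ.map (fun p => (a • p.1 + (1 - a) • p.2, p.2)) ∈
      optCouplings (γ.map fun p => a • p.1 + (1 - a) • p.2) ν := by
  obtain ⟨hγc, hγo⟩ := hγ
  have := hμ.1
  have hγp : IsProbabilityMeasure γ := isProbabilityMeasure_of_mem_couplings hγc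
  have hpm : Measurable fun p : Eu d × Eu d => a • p.1 + (1 - a) • p.2 := by fun_prop
  have hqm : Measurable fun p : Eu d × Eu d => (a • p.1 + (1 - a) • p.2, p.2) := by fun_prop
  have hmem : γ.map (fun p => (a • p.1 + (1 - a) • p.2, p.2)) ∈
      couplings (γ.map fun p => a • p.1 + (1 - a) • p.2) ν := by
    refine ⟨?_, ?_⟩
    · rw [Measure.map_map measurable_fst hqm]; rfl
    · rw [Measure.map_map measurable_snd hqm]; exact hγc.2
  refine ⟨hmem, le_antisymm (le_iInf₂ fun η hη => ?_) (iInf₂_le _ hmem)⟩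
  have hcost : cost sqDist (γ.map fun p => (a • p.1 + (1 - a) • p.2, p.2))
      = ENNReal.ofReal (a ^ 2) * cost sqDist γ := by
    unfold cost
    rw [lintegral_map measurable_sqDist hqm, ← lintegral_const_mul _ measurable_sqDist]
    refine lintegral_congr fun p => ?_
    simp only [sqDist, edist_dist]
    rw [ENNReal.ofReal_pow ha.le, ← mul_pow, ← ENNReal.ofReal_mul ha.le, dist_eq_norm, dist_eq_norm]
    congr 2
    rw [← Real.norm_of_nonneg ha.le, ← norm_smul, Real.norm_of_nonneg ha.le]
    congr 1
    module
  have hηp : IsProbabilityMeasure η :=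
    have := Measure.isProbabilityMeasure_map (μ := γ) hpm.aemeasurable
    isProbabilityMeasure_of_mem_couplings hη
  obtain ⟨ρ, hρ1, hρ2⟩ := exists_gluing γ η hpm hη.1
  have hgm : Measurable (Prod.map (fun p : Eu d × Eu d => a • p.1 + (1 - a) • p.2)
      (id : Eu d → Eu d)) := hpm.prodMap measurable_id
  have hxm : Measurable fun q : (Eu d × Eu d) × Eu d => (q.1.1, q.2) := by fun_prop
  have hρmem : ρ.map (fun q => (q.1.1, q.2)) ∈ couplings μ ν := by
    refine ⟨?_, ?_⟩
    · rw [Measure.map_map measurable_fst hxm, ← hγc.1, ← hρ1,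
        Measure.map_map measurable_fst measurable_fst]
      rfl
    · rw [Measure.map_map measurable_snd hxm, ← hη.2, ← hρ2, Measure.map_map measurable_snd hgm]
      rfl
  have hle : cost sqDist γ ≤ ENNReal.ofReal (1 - a) * cost sqDist γ
      + ENNReal.ofReal a⁻¹ * cost sqDist η := by
    calc cost sqDist γ ≤ cost sqDist (ρ.map fun q => (q.1.1, q.2)) :=
          hγo.trans_le (iInf₂_le _ hρmem)
      _ = ∫⁻ q, sqDist q.1.1 q.2 ∂ρ := lintegral_map measurable_sqDist hxm
      _ ≤ ∫⁻ q, (ENNReal.ofReal (1 - a) * sqDist q.1.1 q.1.2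
          + ENNReal.ofReal a⁻¹ * sqDist (a • q.1.1 + (1 - a) • q.1.2) q.2) ∂ρ :=
          lintegral_mono fun q => sqDist_le_of_segment ha ha1 _ _ _
      _ = ENNReal.ofReal (1 - a) * cost sqDist γ + ENNReal.ofReal a⁻¹ * cost sqDist η := by
          have h1 : Measurable fun q : (Eu d × Eu d) × Eu d => sqDist q.1.1 q.1.2 :=
            measurable_sqDist.comp measurable_fst
          have h2 : Measurable fun q : (Eu d × Eu d) × Eu d =>
              sqDist (a • q.1.1 + (1 - a) • q.1.2) q.2 := by
            unfold sqDist
            fun_prop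
          rw [lintegral_add_left (h1.const_mul _), lintegral_const_mul _ h1,
            lintegral_const_mul _ h2]
          unfold cost
          congr 2
          · conv_rhs => rw [← hρ1, lintegral_map measurable_sqDist measurable_fst]
          · conv_rhs => rw [← hρ2, lintegral_map measurable_sqDist hgm]
            simp only [Prod.map_fst, Prod.map_snd, id_eq]
  rw [hcost]
  have hfin := cost_sqDist_lt_top hμ hν hγc
  rcases eq_or_ne (cost sqDist η) ⊤ with h | h
  · rw [h]; exact le_top
  rw [← ENNReal.ofReal_toReal hfin.ne, ← ENNReal.ofReal_toReal h] at hle ⊢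
  have hC : 0 ≤ (cost sqDist γ).toReal := ENNReal.toReal_nonneg
  have hH : 0 ≤ (cost sqDist η).toReal := ENNReal.toReal_nonneg
  have hb : 0 ≤ 1 - a := by linarith
  rw [← ENNReal.ofReal_mul hb, ← ENNReal.ofReal_mul (by positivity),
    ← ENNReal.ofReal_add (by positivity) (by positivity),
    ENNReal.ofReal_le_ofReal_iff (by positivity)] at hle
  rw [← ENNReal.ofReal_mul (by positivity)]
  apply ENNReal.ofReal_le_ofReal
  have h' : a * (cost sqDist γ).toReal ≤ a⁻¹ * (cost sqDist η).toReal := by linarith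
  calc a ^ 2 * (cost sqDist γ).toReal = a * (a * (cost sqDist γ).toReal) := by ring
    _ ≤ a * (a⁻¹ * (cost sqDist η).toReal) := by gcongr
    _ = (cost sqDist η).toReal := by field_simp

theorem integrable_norm_sub_of_cost_lt_top {d : ℕ} {γ : Measure (Eu d × Eu d)}
    [IsFiniteMeasure γ] (h : cost sqDist γ < ⊤) :
    Integrable (fun p : Eu d × Eu d => ‖p.2 - p.1‖) γ := by
  have hmem : MemLp (fun p : Eu d × Eu d => p.2 - p.1) 2 γ := by
    refine ⟨by fun_prop, ?_⟩
    rw [eLpNorm_lt_top_iff_lintegral_rpow_enorm_lt_top (by simp) (by simp)]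
    refine lt_of_eq_of_lt (lintegral_congr fun p => ?_) h
    simp [sqDist, edist_comm p.1 p.2, edist_eq_enorm_sub]
  exact (hmem.integrable one_le_two).norm

/-- Differentiation of `∫ φ` along the time-rescaled displacement interpolation. -/
theorem hasDerivAt_integral_map_exp_segment {d : ℕ} {γ : Measure (Eu d × Eu d)}
    [IsFiniteMeasure γ] (hγ : Integrable (fun p : Eu d × Eu d => ‖p.2 - p.1‖) γ)
    {φ : Eu d → ℝ} (hφ : ContDiff ℝ (⊤ : ℕ∞) φ) (hφc : HasCompactSupport φ) (t : ℝ) :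
    HasDerivAt
      (fun s => ∫ p : Eu d × Eu d, φ (Real.exp (-s) • p.1 + (1 - Real.exp (-s)) • p.2) ∂γ)
      (∫ p : Eu d × Eu d, fderiv ℝ φ (Real.exp (-t) • p.1 + (1 - Real.exp (-t)) • p.2)
        (Real.exp (-t) • (p.2 - p.1)) ∂γ) t := by
  have hcd : Continuous (fderiv ℝ φ) := hφ.continuous_fderiv (by simp)
  obtain ⟨C, hC⟩ := (hφc.fderiv (𝕜 := ℝ)).exists_bound_of_continuous hcd
  obtain ⟨K, hK⟩ := hφc.exists_bound_of_continuous hφ.continuous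
  have hmeas : ∀ s : ℝ, Continuous fun p : Eu d × Eu d =>
      φ (Real.exp (-s) • p.1 + (1 - Real.exp (-s)) • p.2) := fun s =>
    hφ.continuous.comp (by fun_prop)
  refine (hasDerivAt_integral_of_dominated_loc_of_deriv_le
    (F' := fun s p => fderiv ℝ φ (Real.exp (-s) • p.1 + (1 - Real.exp (-s)) • p.2)
        (Real.exp (-s) • (p.2 - p.1)))
    (bound := fun p => C * Real.exp (1 - t) * ‖p.2 - p.1‖)
    (Metric.ball_mem_nhds t one_pos)
    (Eventually.of_forall fun s => (hmeas s).aestronglyMeasurable) ?_ ?_ ?_ ?_ ?_).2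
  · exact Integrable.of_bound (hmeas t).aestronglyMeasurable K (ae_of_all _ fun p => hK _)
  · exact Continuous.aestronglyMeasurable ((hcd.comp (by fun_prop)).clm_apply (by fun_prop))
  · refine ae_of_all _ fun p s hs => ?_
    refine (ContinuousLinearMap.le_opNorm _ _).trans ?_
    rw [norm_smul, Real.norm_of_nonneg (Real.exp_pos _).le, mul_assoc]
    have hs' : t - s < 1 := by
      rw [Metric.mem_ball, Real.dist_eq] at hs
      linarith [(abs_lt.1 hs).1]
    have hexp : Real.exp (-s) ≤ Real.exp (1 - t) := Real.exp_le_exp.2 (by linarith)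
    have hC0 : 0 ≤ C := (norm_nonneg _).trans (hC 0)
    gcongr
    exact hC _
  · exact hγ.const_mul _
  · refine ae_of_all _ fun p s _ => ?_
    have he : HasDerivAt (fun s : ℝ => Real.exp (-s)) (-Real.exp (-s)) s := by
      simpa using (hasDerivAt_neg s).exp
    have hseg : HasDerivAt (fun s : ℝ => Real.exp (-s) • p.1 + (1 - Real.exp (-s)) • p.2)
        (Real.exp (-s) • (p.2 - p.1)) s := by
      refine ((he.smul_const p.1).add ((he.const_sub 1).smul_const p.2)).congr_deriv ?_
      module
    exact ((hφ.differentiable (by simp)) _).hasFDerivAt.comp_hasDerivAt s hseg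

/-- Given `γ ∈ Γ_o(μ₀, μ̄)` and the induced geodesic
`μ_τ = (π_τ)_# γ`, the time-rescaled curve `ν_t = μ_{1−e^{−t}}` solves the MDI
`ν̇_t ∈ (π₀, π₁−π₀)_# Γ_o(ν_t, μ̄)` with `ν₀ = μ₀`: for every `φ ∈ C_c^∞(ℝᵈ)` and
every `t ≥ 0` there is `γ_t ∈ Γ_o(ν_t, μ̄)` with
`(d/dt) ∫ φ dν_t = ∫ v·∇φ(x) d[(π₀, π₁−π₀)_# γ_t]`. -/
theorem geodesics_solve_MDI {d : ℕ} (μ₀ μb : Measure (Eu d))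
    (hμ₀ : μ₀ ∈ P2 (Eu d)) (hμb : μb ∈ P2 (Eu d))
    (γ : Measure (Eu d × Eu d)) (hγ : γ ∈ optCouplings μ₀ μb)
    (ν : ℝ → Measure (Eu d))
    (hν : ∀ t : ℝ, ν t =
      γ.map (fun p : Eu d × Eu d => Real.exp (-t) • p.1 + (1 - Real.exp (-t)) • p.2)) :
    ν 0 = μ₀ ∧
    ∀ (φ : Eu d → ℝ), ContDiff ℝ (⊤ : ℕ∞) φ → HasCompactSupport φ →
      ∀ t : ℝ, 0 ≤ t →
        ∃ γt ∈ optCouplings (ν t) μb,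
          HasDerivAt (fun s => ∫ x, φ x ∂(ν s))
            (∫ p : Eu d × Eu d, fderiv ℝ φ p.1 p.2
              ∂(γt.map (fun p : Eu d × Eu d => (p.1, p.2 - p.1)))) t := by
  have := hμ₀.1
  have hγp : IsProbabilityMeasure γ := isProbabilityMeasure_of_mem_couplings hγ.1
  refine ⟨?_, fun φ hφ hφc t ht => ?_⟩
  · rw [hν 0, ← hγ.1.1]
    simp
  have hseg : ∀ s : ℝ, Measurable fun p : Eu d × Eu d =>
      Real.exp (-s) • p.1 + (1 - Real.exp (-s)) • p.2 := fun s => by fun_prop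
  refine ⟨γ.map (fun p => (Real.exp (-t) • p.1 + (1 - Real.exp (-t)) • p.2, p.2)), ?_, ?_⟩
  · rw [hν t]
    exact map_segment_mem_optCouplings hμ₀ hμb hγ (Real.exp_pos _)
      (Real.exp_le_one_iff.2 (by linarith))
  · have hint := integrable_norm_sub_of_cost_lt_top (cost_sqDist_lt_top hμ₀ hμb hγ.1)
    have hcd : Continuous (fderiv ℝ φ) := hφ.continuous_fderiv (by simp)
    have hcont : Continuous fun p : Eu d × Eu d => fderiv ℝ φ p.1 p.2 :=
      (hcd.comp continuous_fst).clm_apply continuous_snd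
    convert hasDerivAt_integral_map_exp_segment hint hφ hφc t using 1
    · funext s
      rw [hν s, integral_map (hseg s).aemeasurable hφ.continuous.aestronglyMeasurable]
    · rw [Measure.map_map (by fun_prop) (by fun_prop),
        integral_map (by fun_prop) hcont.aestronglyMeasurable]
      refine integral_congr_ae (ae_of_all _ fun p => ?_)
      simp only [Function.comp_apply]
      congr 1
      module

end
end
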